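/- Let 0 < α ≤ 2π/3, let R > 0, let V be a finite set of points of the Euclidean plane, let r : V → ℝ be a CBTC(α)-valid radius assignment, and let u, v ∈ V be distinct with (u,v) ∈ N_α (i.e. dist u v ≤ r u). Then there exists a finite sequence of points u = u_0, u_1, …, u_k = v in V such that for every i < k, u_i and u_{i+1} are adjacent in G_α⁻, i.e. u_i ≠ u_{i+1} and dist u_i u_{i+1} ≤ min (r u_i) (r u_{i+1}). -/

import Mathlib

open EuclideanGeometry Real

noncomputable section

/-- The Euclidean plane. -/
abbrev EPlane := EuclideanSpace ℝ (Fin 2)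

/-- Adjacency in the graph `G_R`: two distinct points of `V` at distance at most `R`. -/
def GRAdj (R : ℝ) (V : Finset EPlane) (u v : EPlane) : Prop :=
  u ∈ V ∧ v ∈ V ∧ u ≠ v ∧ dist u v ≤ R

/-- A radius assignment `r` is CBTC(α)-valid if every `u ∈ V` has `0 < r u ≤ R` and
either `r u = R` or `u` has no α-gap: every direction `e` is within angle `α/2`
of some neighbor of `u` at distance at most `r u`. -/
def CBTCValid (α R : ℝ) (V : Finset EPlane) (r : EPlane → ℝ) : Prop :=
  ∀ u ∈ V, (0 < r u ∧ r u ≤ R) ∧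
    (r u = R ∨ ∀ e : EPlane, e ≠ 0 → ∃ v ∈ V, v ≠ u ∧ dist u v ≤ r u ∧
      InnerProductGeometry.angle (v - u) e ≤ α / 2)

/-- Adjacency in the graph `G_α` (symmetric closure of `N_α`):
two distinct points of `V` with `dist u v ≤ max (r u) (r v)`. -/
def GAlphaAdj (V : Finset EPlane) (r : EPlane → ℝ) (u v : EPlane) : Prop :=
  u ∈ V ∧ v ∈ V ∧ u ≠ v ∧ dist u v ≤ max (r u) (r v)

/-- If two vectors form an angle of at most `π / 3`, the nonzero vector `x` being shorter than `y`,
then their difference is shorter than `y`. -/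
theorem norm_sub_lt_of_angle_le_pi_div_three {E : Type*} [NormedAddCommGroup E]
    [InnerProductSpace ℝ E] {x y : E} (hx : x ≠ 0) (hxy : ‖x‖ < ‖y‖)
    (h : InnerProductGeometry.angle x y ≤ π / 3) : ‖x - y‖ < ‖y‖ := by
  have hcos : 1 / 2 ≤ Real.cos (InnerProductGeometry.angle x y) := by
    rw [← Real.cos_pi_div_three]
    exact Real.cos_le_cos_of_nonneg_of_le_pi (InnerProductGeometry.angle_nonneg x y)
      (by linarith [Real.pi_pos]) h
  have hinner := InnerProductGeometry.cos_angle_mul_norm_mul_norm x y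
  have hx0 : 0 < ‖x‖ := norm_pos_iff.mpr hx
  have hprod : 0 < ‖x‖ * ‖y‖ := mul_pos hx0 (hx0.trans hxy)
  have hsq := norm_sub_sq_real x y
  have hle : ‖x‖ * ‖y‖ ≤ 2 * inner ℝ x y := by nlinarith
  refine lt_of_pow_lt_pow_left₀ 2 (norm_nonneg y) ?_
  nlinarith

/-- A chain of related elements can be listed as a finite sequence. -/
theorem Relation.ReflTransGen.exists_seq {β : Type*} {S : β → β → Prop} {a b : β}
    (h : Relation.ReflTransGen S a b) :
    ∃ (k : ℕ) (p : ℕ → β), p 0 = a ∧ p k = b ∧ ∀ i < k, S (p i) (p (i + 1)) := by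
  induction h using Relation.ReflTransGen.head_induction_on with
  | refl => exact ⟨0, fun _ => b, rfl, rfl, by simp⟩
  | @head a c hac _ ih =>
    obtain ⟨k, p, h0, hk, hp⟩ := ih
    refine ⟨k + 1, fun n => Nat.casesOn n a p, rfl, hk, ?_⟩
    rintro (_ | i) hi
    · simpa [h0] using hac
    · exact hp i (by lia)

/-- Adjacency in the graph `G_α⁻`: two distinct points of `V` with `dist u v ≤ min (r u) (r v)`. -/
def GAlphaMinusAdj (V : Finset EPlane) (r : EPlane → ℝ) (u v : EPlane) : Prop :=
  u ∈ V ∧ v ∈ V ∧ u ≠ v ∧ dist u v ≤ min (r u) (r v)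

theorem GAlphaMinusAdj.symm {V : Finset EPlane} {r : EPlane → ℝ} {u v : EPlane}
    (h : GAlphaMinusAdj V r u v) : GAlphaMinusAdj V r v u :=
  ⟨h.2.1, h.1, h.2.2.1.symm, by rw [dist_comm, min_comm]; exact h.2.2.2⟩

/-- If `(u, v)` is in `N_α` but `(v, u)` is not, then `v` has a neighbor `w` within distance `r v`
that is closer to `u` than `v` is. -/
theorem CBTCValid.exists_closer {α R : ℝ} {V : Finset EPlane} {r : EPlane → ℝ}
    (hr : CBTCValid α R V r) (hα : α ≤ 2 * π / 3) {u v : EPlane} (hu : u ∈ V) (hv : v ∈ V)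
    (huv : u ≠ v) (hN : dist u v ≤ r u) (hlt : r v < dist u v) :
    ∃ w ∈ V, w ≠ v ∧ dist v w ≤ r v ∧ dist u w < dist u v := by
  rcases (hr v hv).2 with hR | hgap
  · linarith [(hr u hu).1.2]
  obtain ⟨w, hw, hwv, hd, hangle⟩ := hgap (u - v) (sub_ne_zero.mpr huv)
  refine ⟨w, hw, hwv, hd, ?_⟩
  have hshort := norm_sub_lt_of_angle_le_pi_div_three (sub_ne_zero.mpr hwv)
    (by rw [← dist_eq_norm, ← dist_eq_norm, dist_comm w v]; linarith)
    (hangle.trans (by linarith))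
  rwa [sub_sub_sub_cancel_right, ← dist_eq_norm, ← dist_eq_norm, dist_comm w u] at hshort

/-- A directed edge of `N_α` joins two points in the same component of `G_α⁻`. -/
theorem CBTCValid.reflTransGen_gAlphaMinusAdj {α R : ℝ} {V : Finset EPlane} {r : EPlane → ℝ}
    (hr : CBTCValid α R V r) (hα : α ≤ 2 * π / 3) {u v : EPlane} (hu : u ∈ V) (hv : v ∈ V)
    (huv : u ≠ v) (hN : dist u v ≤ r u) :
    Relation.ReflTransGen (GAlphaMinusAdj V r) u v := by
  classical
  by_contra hbad
  obtain ⟨⟨a, b⟩, hab, hmin⟩ := Finset.exists_min_image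
    ((V ×ˢ V).filter fun q => q.1 ≠ q.2 ∧ dist q.1 q.2 ≤ r q.1 ∧
      ¬ Relation.ReflTransGen (GAlphaMinusAdj V r) q.1 q.2)
    (fun q => dist q.1 q.2)
    ⟨(u, v), Finset.mem_filter.mpr ⟨Finset.mk_mem_product hu hv, huv, hN, hbad⟩⟩
  simp only [Finset.mem_filter, Finset.mem_product] at hab hmin
  obtain ⟨⟨ha, hb⟩, hne, hd, hnot⟩ := hab
  have hshorter : ∀ c ∈ V, ∀ d ∈ V, c ≠ d → dist c d ≤ r c → dist c d < dist a b →
      Relation.ReflTransGen (GAlphaMinusAdj V r) c d := by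
    intro c hc d hd hcd hrc hlt
    by_contra hn
    exact absurd (hmin (c, d) ⟨⟨hc, hd⟩, hcd, hrc, hn⟩) (not_le.mpr hlt)
  rcases le_or_gt (dist a b) (r b) with hle | hlt
  · exact hnot (.single ⟨ha, hb, hne, le_min hd hle⟩)
  obtain ⟨w, hw, hwb, hbw, haw⟩ := hr.exists_closer hα ha hb hne hd hlt
  have hwa : a ≠ w := by
    rintro rfl
    rw [dist_comm] at hbw
    linarith
  have hb_w := hshorter b hb w hw hwb.symm hbw (hbw.trans_lt hlt)
  have hw_b : Relation.ReflTransGen (GAlphaMinusAdj V r) w b :=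
    Relation.reflTransGen_swap.mp (Relation.ReflTransGen.mono (fun _ _ h => h.symm) _ _ hb_w)
  exact hnot ((hshorter a ha w hw hwa (haw.le.trans hd) haw).trans hw_b)

/-- For `0 < α ≤ 2π/3`: if `(u,v) ∈ N_α`, then `u` and `v` are joined by a path
consisting of edges of `G_α⁻`. -/
theorem cbtc_symmetric_path_of_directed (α R : ℝ) (hα : 0 < α)
    (hα' : α ≤ 2 * Real.pi / 3) (hR : 0 < R) (V : Finset EPlane) (r : EPlane → ℝ)
    (hr : CBTCValid α R V r) (u v : EPlane) (hu : u ∈ V) (hv : v ∈ V) (huv : u ≠ v)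
    (hN : dist u v ≤ r u) :
    ∃ (k : ℕ) (p : ℕ → EPlane), p 0 = u ∧ p k = v ∧ (∀ i ≤ k, p i ∈ V) ∧
      ∀ i < k, p i ≠ p (i + 1) ∧
        dist (p i) (p (i + 1)) ≤ min (r (p i)) (r (p (i + 1))) := by
  obtain ⟨k, p, h0, hk, hp⟩ := (hr.reflTransGen_gAlphaMinusAdj hα' hu hv huv hN).exists_seq
  refine ⟨k, p, h0, hk, fun i hi => ?_, fun i hi => (hp i hi).2.2⟩
  rcases hi.lt_or_eq with hlt | rfl
  · exact (hp i hlt).1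
  · rwa [hk]
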